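/- arXiv:2107.11908 — 6 statements merged into one kernel-verified Lean document; each statement's English description precedes it below -/
import Mathlib

section
/- Let f : ℝⁿ → ℝ be differentiable at a point x ∈ ℝⁿ, and let g ∈ ℝⁿ, u_g > 0, β > 0 be such that ‖∇f(x) − g‖ ≤ u_g β ‖g‖, u_g β < 1, and g ≠ 0. Then ⟨∇f(x), g⟩ ≥ (1 − u_g β) ‖g‖² > 0; in particular −g is a descent direction for f at x, i.e. −⟨∇f(x), −g⟩ < 0. -/
open scoped RealInnerProductSpace

/-- If `f` is differentiable at `x`, `‖∇f(x) − g‖ ≤ u_g β ‖g‖`,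
`u_g β < 1` and `g ≠ 0`, then `⟪∇f(x), g⟫ ≥ (1 − u_g β)‖g‖² > 0`; in particular
`−g` is a descent direction for `f` at `x`. -/
theorem full_low_eval_neg_approx_grad_descent {n : ℕ}
    (f : EuclideanSpace ℝ (Fin n) → ℝ) (x g : EuclideanSpace ℝ (Fin n))
    (u_g β : ℝ) (hf : DifferentiableAt ℝ f x)
    (hug : 0 < u_g) (hβ : 0 < β)
    (herr : ‖gradient f x - g‖ ≤ u_g * β * ‖g‖)
    (hsmall : u_g * β < 1) (hg : g ≠ 0) :
    ⟪gradient f x, g⟫ ≥ (1 - u_g * β) * ‖g‖ ^ 2 ∧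
      (1 - u_g * β) * ‖g‖ ^ 2 > 0 ∧
      ⟪gradient f x, -g⟫ < 0 := by
  have hgpos : 0 < ‖g‖ := norm_pos_iff.mpr hg
  have h2 : 0 < (1 - u_g * β) * ‖g‖ ^ 2 := mul_pos (by linarith) (by positivity)
  have h1 : ⟪gradient f x, g⟫ ≥ (1 - u_g * β) * ‖g‖ ^ 2 := by
    have hsplit : ⟪gradient f x, g⟫ = ⟪gradient f x - g, g⟫ + ‖g‖ ^ 2 := by
      rw [inner_sub_left, real_inner_self_eq_norm_sq]
      ring
    have hcs := neg_le_of_abs_le (abs_real_inner_le_norm (gradient f x - g) g)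
    have hm := mul_le_mul_of_nonneg_right herr hgpos.le
    rw [hsplit]
    nlinarith
  refine ⟨h1, h2, ?_⟩
  rw [inner_neg_right]
  linarith
end

section
/- Let f : ℝⁿ → ℝ be differentiable at a point x ∈ ℝⁿ, and let g, p ∈ ℝⁿ, u_g > 0, κ > 0, β > 0 be such that ‖∇f(x) − g‖ ≤ u_g β ‖g‖, ⟨−g, p⟩ > κ ‖g‖ ‖p‖, g ≠ 0, p ≠ 0, and u_g β < κ. Then −⟨∇f(x), p⟩ ≥ (κ − u_g β) ‖g‖ ‖p‖ > 0; in particular p is a descent direction for f at x. -/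
open scoped RealInnerProductSpace

/-- If `f` is differentiable at `x`, `‖∇f(x) − g‖ ≤ u_g β ‖g‖`,
`⟪−g, p⟫ > κ ‖g‖ ‖p‖`, `g ≠ 0`, `p ≠ 0` and `u_g β < κ`, then
`−⟪∇f(x), p⟫ ≥ (κ − u_g β) ‖g‖ ‖p‖ > 0`; in particular `p` is a descent
direction for `f` at `x`. -/
theorem full_low_eval_pk_descent {n : ℕ}
    (f : EuclideanSpace ℝ (Fin n) → ℝ) (x g p : EuclideanSpace ℝ (Fin n))
    (u_g κ β : ℝ) (hf : DifferentiableAt ℝ f x)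
    (hug : 0 < u_g) (hκ : 0 < κ) (hβ : 0 < β)
    (herr : ‖gradient f x - g‖ ≤ u_g * β * ‖g‖)
    (hangle : ⟪-g, p⟫ > κ * (‖g‖ * ‖p‖))
    (hg : g ≠ 0) (hp : p ≠ 0)
    (hsmall : u_g * β < κ) :
    -⟪gradient f x, p⟫ ≥ (κ - u_g * β) * (‖g‖ * ‖p‖) ∧
      (κ - u_g * β) * (‖g‖ * ‖p‖) > 0 ∧
      ⟪gradient f x, p⟫ < 0 := by
  have h1 := abs_real_inner_le_norm (gradient f x - g) p
  have h2 := mul_le_mul_of_nonneg_right herr (norm_nonneg p)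
  have h3 := neg_abs_le ⟪gradient f x - g, p⟫
  have hpos : (κ - u_g * β) * (‖g‖ * ‖p‖) > 0 :=
    mul_pos (sub_pos.mpr hsmall) (mul_pos (norm_pos_iff.mpr hg) (norm_pos_iff.mpr hp))
  have h4 := le_abs_self ⟪gradient f x - g, p⟫
  rw [inner_neg_left] at hangle
  have h5 : ⟪gradient f x - g, p⟫ = ⟪gradient f x, p⟫ - ⟪g, p⟫ := inner_sub_left _ _ _
  have key : -⟪gradient f x, p⟫ ≥ (κ - u_g * β) * (‖g‖ * ‖p‖) := by
    linarith
  exact ⟨key, hpos, by linarith⟩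
end

section
/- Let f : ℝⁿ → ℝ be differentiable with gradient ∇f Lipschitz continuous with constant L > 0. Let x, g, p ∈ ℝⁿ, β > 0, u_g > 0, u_p > 0 be such that ‖∇f(x) − g‖ ≤ u_g β ‖g‖ and ‖g‖ ≤ u_p ‖p‖. Then f(x + β p) ≤ f(x) + β ⟨g, p⟩ + (L/2 + u_g u_p) β² ‖p‖². -/
open scoped RealInnerProductSpace

/-- For `f` L-smooth (differentiable with L-Lipschitz gradient),
if `‖∇f(x) − g‖ ≤ u_g β ‖g‖` and `‖g‖ ≤ u_p ‖p‖`, then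
`f(x + β p) ≤ f(x) + β ⟪g, p⟫ + (L/2 + u_g u_p) β² ‖p‖²`. -/
theorem full_low_eval_descent_lemma {n : ℕ}
    (f : EuclideanSpace ℝ (Fin n) → ℝ) (L : ℝ) (hL : 0 < L)
    (hdiff : Differentiable ℝ f)
    (hlip : ∀ y z : EuclideanSpace ℝ (Fin n),
      ‖gradient f y - gradient f z‖ ≤ L * ‖y - z‖)
    (x g p : EuclideanSpace ℝ (Fin n)) (β u_g u_p : ℝ)
    (hβ : 0 < β) (hug : 0 < u_g) (hup : 0 < u_p)
    (herr : ‖gradient f x - g‖ ≤ u_g * β * ‖g‖)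
    (hgp : ‖g‖ ≤ u_p * ‖p‖) :
    f (x + β • p) ≤ f x + β * ⟪g, p⟫ + (L / 2 + u_g * u_p) * β ^ 2 * ‖p‖ ^ 2 := by
  have hφ : ∀ t : ℝ, HasDerivAt (fun t : ℝ => f (x + t • p)) ⟪gradient f (x + t • p), p⟫ t := by
    intro t
    have h1 := (hdiff (x + t • p)).hasGradientAt.hasFDerivAt
    have h2 : HasDerivAt (fun t : ℝ => x + t • p) p t := by
      simpa using ((hasDerivAt_id t).smul_const p).const_add x
    exact h1.comp_hasDerivAt t h2
  have hB : ∀ t : ℝ, HasDerivAt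
      (fun t : ℝ => f x + t * ⟪gradient f x, p⟫ + L / 2 * t ^ 2 * ‖p‖ ^ 2)
      (⟪gradient f x, p⟫ + L * t * ‖p‖ ^ 2) t := by
    intro t
    have h1 := ((hasDerivAt_id t).mul_const ⟪gradient f x, p⟫).const_add (f x)
    have h2 := (((hasDerivAt_id t).pow 2).const_mul (L / 2)).mul_const (‖p‖ ^ 2)
    refine (h1.add h2).congr_deriv ?_
    simp only [id, Nat.cast_ofNat]
    ring
  have key := image_le_of_deriv_right_le_deriv_boundary (a := 0) (b := β)
    (fun t _ => (hφ t).continuousAt.continuousWithinAt)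
    (fun t _ => (hφ t).hasDerivWithinAt)
    (by simp)
    (fun t _ => (hB t).continuousAt.continuousWithinAt)
    (fun t _ => (hB t).hasDerivWithinAt)
    (by
      intro t ht
      have h1 := real_inner_le_norm (gradient f (x + t • p) - gradient f x) p
      have h2 := hlip (x + t • p) x
      rw [add_sub_cancel_left, norm_smul, Real.norm_of_nonneg ht.1] at h2
      rw [inner_sub_left] at h1
      have h3 := mul_le_mul_of_nonneg_right h2 (norm_nonneg p)
      nlinarith)
    (Set.right_mem_Icc.2 hβ.le)
  have h1 := real_inner_le_norm (gradient f x - g) p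
  rw [inner_sub_left] at h1
  have h2 : ‖gradient f x - g‖ * ‖p‖ ≤ u_g * β * (u_p * ‖p‖) * ‖p‖ := by
    refine mul_le_mul_of_nonneg_right (herr.trans ?_) (norm_nonneg p)
    exact mul_le_mul_of_nonneg_left hgp (by positivity)
  have h3 := mul_le_mul_of_nonneg_left (h1.trans h2) hβ.le
  refine key.trans ?_
  linarith
end

section
/- (Lemma 3.1, stepsize lower bound for backtracking.) Let f : ℝⁿ → ℝ be L-smooth. Let c, τ ∈ (0,1), β̄ > 0, u_g > 0, u_p > 0, and let x, g, p ∈ ℝⁿ with p ≠ 0, and β ∈ (0, β̄] be such that ‖∇f(x) − g‖ ≤ u_g β ‖g‖ and ‖g‖ ≤ u_p ‖p‖. Assume that either β = β̄, or the sufficient decrease condition fails at stepsize β/τ, i.e. f(x + (β/τ) p) − f(x) > c (β/τ) ⟨g, p⟩. Then β ≥ min{ β̄, (2 τ (1 − c) / (2 u_g u_p + L)) · ⟨−g, p⟩ / ‖p‖² }. -/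
open scoped RealInnerProductSpace

/-- Descent lemma along a ray. -/
lemma descent_aux {n : ℕ}
    (f : EuclideanSpace ℝ (Fin n) → ℝ) (L : ℝ)
    (hdiff : Differentiable ℝ f)
    (hlip : ∀ y z : EuclideanSpace ℝ (Fin n),
      ‖gradient f y - gradient f z‖ ≤ L * ‖y - z‖)
    (x p : EuclideanSpace ℝ (Fin n)) (t : ℝ) (ht : 0 ≤ t) :
    f (x + t • p) ≤ f x + t * ⟪gradient f x, p⟫ + L / 2 * t ^ 2 * ‖p‖ ^ 2 := by
  have hd : ∀ s : ℝ, HasDerivAt (fun s : ℝ => f (x + s • p)) ⟪gradient f (x + s • p), p⟫ s := by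
    intro s
    have h1 : HasDerivAt (fun s : ℝ => x + s • p) p s := by
      simpa using ((hasDerivAt_id s).smul_const p).const_add x
    have h2 := (hdiff (x + s • p)).hasFDerivAt
    have h3 : ⟪gradient f (x + s • p), p⟫ = fderiv ℝ f (x + s • p) p := by
      simp [gradient]
    rw [h3]
    exact h2.comp_hasDerivAt s h1
  have hB : ∀ s : ℝ, HasDerivAt
      (fun s : ℝ => f x + s * ⟪gradient f x, p⟫ + L / 2 * s ^ 2 * ‖p‖ ^ 2)
      (⟪gradient f x, p⟫ + L * s * ‖p‖ ^ 2) s := by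
    intro s
    have h1 := (((hasDerivAt_id s).mul_const ⟪gradient f x, p⟫).const_add (f x)).add
      ((((hasDerivAt_id s).pow 2).const_mul (L / 2)).mul_const (‖p‖ ^ 2))
    refine h1.congr_deriv ?_
    simp only [id, Nat.cast_ofNat, Nat.add_one_sub_one, pow_one]
    ring
  refine image_le_of_deriv_right_le_deriv_boundary (a := 0) (b := t)
    (f := fun s : ℝ => f (x + s • p))
    (f' := fun s => ⟪gradient f (x + s • p), p⟫)
    (B := fun s : ℝ => f x + s * ⟪gradient f x, p⟫ + L / 2 * s ^ 2 * ‖p‖ ^ 2)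
    (B' := fun s => ⟪gradient f x, p⟫ + L * s * ‖p‖ ^ 2)
    (fun s _ => (hd s).continuousAt.continuousWithinAt)
    (fun s _ => (hd s).hasDerivWithinAt) (by simp)
    (fun s _ => (hB s).continuousAt.continuousWithinAt)
    (fun s _ => (hB s).hasDerivWithinAt) ?_ ⟨ht, le_rfl⟩
  intro s hs
  have h1 := real_inner_le_norm (gradient f (x + s • p) - gradient f x) p
  have h2 := hlip (x + s • p) x
  rw [add_sub_cancel_left, norm_smul, Real.norm_eq_abs, abs_of_nonneg hs.1] at h2
  rw [inner_sub_left] at h1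
  have h3 := mul_le_mul_of_nonneg_right h2 (norm_nonneg p)
  show ⟪gradient f (x + s • p), p⟫ ≤ ⟪gradient f x, p⟫ + L * s * ‖p‖ ^ 2
  nlinarith

/-- **Lemma 3.1.** Stepsize lower bound for backtracking: if the
stepsize `β ∈ (0, β̄]` either equals `β̄` or is such that sufficient decrease
fails at `β/τ`, then
`β ≥ min{β̄, (2τ(1−c)/(2 u_g u_p + L)) ⟪−g, p⟫/‖p‖²}`. -/
theorem full_low_eval_stepsize_lower_bound {n : ℕ}
    (f : EuclideanSpace ℝ (Fin n) → ℝ) (L : ℝ) (hL : 0 < L)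
    (hdiff : Differentiable ℝ f)
    (hlip : ∀ y z : EuclideanSpace ℝ (Fin n),
      ‖gradient f y - gradient f z‖ ≤ L * ‖y - z‖)
    (c τ βbar u_g u_p : ℝ)
    (hc : 0 < c) (hc1 : c < 1) (hτ : 0 < τ) (hτ1 : τ < 1)
    (hβbar : 0 < βbar) (hug : 0 < u_g) (hup : 0 < u_p)
    (x g p : EuclideanSpace ℝ (Fin n)) (hp : p ≠ 0)
    (β : ℝ) (hβpos : 0 < β) (hβle : β ≤ βbar)
    (herr : ‖gradient f x - g‖ ≤ u_g * β * ‖g‖)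
    (hgp : ‖g‖ ≤ u_p * ‖p‖)
    (hfail : β = βbar ∨ f (x + (β / τ) • p) - f x > c * (β / τ) * ⟪g, p⟫) :
    β ≥ min βbar (2 * τ * (1 - c) / (2 * u_g * u_p + L) * (⟪-g, p⟫ / ‖p‖ ^ 2)) := by
  rcases hfail with h | h
  · exact h ▸ min_le_left _ _
  refine le_trans (min_le_right _ _) ?_
  have hpn : 0 < ‖p‖ := norm_pos_iff.mpr hp
  obtain ⟨t, rfl⟩ : ∃ t, β = τ * t := ⟨β / τ, by field_simp⟩
  have htt : τ * t / τ = t := by field_simp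
  rw [htt] at h
  have ht : 0 < t := pos_of_mul_pos_right hβpos hτ.le
  have hdes := descent_aux f L hdiff hlip x p t ht.le
  have h1 := real_inner_le_norm (gradient f x - g) p
  rw [inner_sub_left] at h1
  have h2 : ‖gradient f x - g‖ * ‖p‖ ≤ u_g * (τ * t) * (u_p * ‖p‖) * ‖p‖ := by
    gcongr
    exact herr.trans (by gcongr)
  have h3 : t * (c * ⟪g, p⟫) <
      t * (⟪g, p⟫ + u_g * (τ * t) * (u_p * ‖p‖) * ‖p‖ + L / 2 * t * ‖p‖ ^ 2) := by
    have := mul_le_mul_of_nonneg_left (h1.trans h2) ht.le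
    nlinarith
  have h4 := lt_of_mul_lt_mul_left h3 ht.le
  have h5 := mul_lt_mul_of_pos_left h4 hτ
  have h6 : τ * (u_g * (τ * t) * (u_p * ‖p‖) * ‖p‖) ≤
      1 * (u_g * (τ * t) * (u_p * ‖p‖) * ‖p‖) := by gcongr
  rw [inner_neg_left, div_mul_div_comm, div_le_iff₀ (by positivity)]
  nlinarith
end

section
/- (Lemma 3.3, Full-Eval failure drives the direct-search stepsize to zero.) Let f : ℝⁿ → ℝ be bounded below by f_low ∈ ℝ. Let ρ : ℝ → ℝ be positive and non-decreasing on (0, ∞). Let C > 0, λ ≥ 1, θ ∈ (0,1). Let (x_k) be a bounded sequence in ℝⁿ and (α_k) a sequence with α_0 > 0, and let ℕ be partitioned into four disjoint sets SF, UF, SL, UL such that: for k ∈ SF, f(x_{k+1}) ≤ f(x_k) − C ρ(α_k) and α_{k+1} = α_k; for k ∈ UF, x_{k+1} = x_k, α_{k+1} = α_k, and k+1 ∈ SL ∪ UL; for k ∈ SL, f(x_{k+1}) ≤ f(x_k) − ρ(α_k) and α_{k+1} = λ α_k; and for k ∈ UL, x_{k+1} = x_k and α_{k+1} = θ α_k.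 Then α_k → 0 as k → ∞, the set UL is infinite, and there exist a point x_* ∈ ℝⁿ and an infinite subset K ⊆ UL such that x_k → x_* and α_k → 0 along K. -/
open Filter Topology

/-- **Lemma 3.3.** Under Full-Eval failure, the direct-search
stepsize tends to zero, there are infinitely many unsuccessful Low-Eval
iterations, and some subsequence of unsuccessful Low-Eval iterates converges
to a point `x_*` with `α_k → 0` along it. -/
theorem full_low_eval_stepsize_to_zero {n : ℕ}
    (f : EuclideanSpace ℝ (Fin n) → ℝ) (f_low : ℝ)
    (hflow : ∀ y, f_low ≤ f y)
    (ρ : ℝ → ℝ)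
    (hρpos : ∀ a : ℝ, 0 < a → 0 < ρ a)
    (hρmono : ∀ a b : ℝ, 0 < a → a ≤ b → ρ a ≤ ρ b)
    (C lam θ : ℝ) (hC : 0 < C) (hlam : 1 ≤ lam) (hθ0 : 0 < θ) (hθ1 : θ < 1)
    (x : ℕ → EuclideanSpace ℝ (Fin n))
    (hbdd : Bornology.IsBounded (Set.range x))
    (α : ℕ → ℝ) (hα0 : 0 < α 0)
    (SF UF SL UL : Set ℕ)
    (hcover : SF ∪ UF ∪ SL ∪ UL = Set.univ)
    (hd1 : Disjoint SF UF) (hd2 : Disjoint SF SL) (hd3 : Disjoint SF UL)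
    (hd4 : Disjoint UF SL) (hd5 : Disjoint UF UL) (hd6 : Disjoint SL UL)
    (hSF : ∀ k ∈ SF, f (x (k + 1)) ≤ f (x k) - C * ρ (α k) ∧ α (k + 1) = α k)
    (hUF : ∀ k ∈ UF, x (k + 1) = x k ∧ α (k + 1) = α k ∧ (k + 1) ∈ SL ∪ UL)
    (hSL : ∀ k ∈ SL, f (x (k + 1)) ≤ f (x k) - ρ (α k) ∧ α (k + 1) = lam * α k)
    (hUL : ∀ k ∈ UL, x (k + 1) = x k ∧ α (k + 1) = θ * α k) :
    Tendsto α atTop (𝓝 0) ∧ UL.Infinite ∧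
      ∃ (xstar : EuclideanSpace ℝ (Fin n)) (K : Set ℕ),
        K ⊆ UL ∧ K.Infinite ∧
        Tendsto x (atTop ⊓ 𝓟 K) (𝓝 xstar) ∧
        Tendsto α (atTop ⊓ 𝓟 K) (𝓝 0) := by
  have hcase : ∀ k, k ∈ SF ∨ k ∈ UF ∨ k ∈ SL ∨ k ∈ UL := by
    intro k
    have : k ∈ SF ∪ UF ∪ SL ∪ UL := by rw [hcover]; trivial
    simp only [Set.mem_union] at this
    tauto
  have hlam0 : 0 < lam := by linarith
  have hpos : ∀ k, 0 < α k := by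
    intro k
    induction k with
    | zero => exact hα0
    | succ k ih =>
      rcases hcase k with h | h | h | h
      · rw [(hSF k h).2]; exact ih
      · rw [(hUF k h).2.1]; exact ih
      · rw [(hSL k h).2]; positivity
      · rw [(hUL k h).2]; positivity
  have hanti : Antitone (fun k => f (x k)) := by
    apply antitone_nat_of_succ_le
    intro k
    have hr := hρpos _ (hpos k)
    rcases hcase k with h | h | h | h
    · have := (hSF k h).1
      have := mul_pos hC hr
      linarith
    · rw [(hUF k h).1]
    · have := (hSL k h).1
      linarith
    · rw [(hUL k h).1]
  have hlim : Tendsto (fun k => f (x k) - f (x (k + 1))) atTop (𝓝 0) := by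
    have h1 := tendsto_atTop_ciInf hanti ⟨f_low, by rintro _ ⟨k, rfl⟩; exact hflow _⟩
    have h2 := h1.comp (tendsto_add_atTop_nat 1)
    simpa using h1.sub h2
  -- eventually, large stepsizes only occur at unsuccessful iterations
  have hlarge : ∀ ε : ℝ, 0 < ε → ∃ N, ∀ k, N ≤ k → ε ≤ α k → k ∈ UF ∨ k ∈ UL := by
    intro ε hε
    have hr := hρpos ε hε
    have hev := (hlim.eventually (gt_mem_nhds (mul_pos hC hr))).and
      (hlim.eventually (gt_mem_nhds hr))
    obtain ⟨N, hN⟩ := eventually_atTop.1 hev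
    refine ⟨N, fun k hk hle => ?_⟩
    obtain ⟨h1, h2⟩ := hN k hk
    have hm := hρmono ε (α k) hε hle
    rcases hcase k with h | h | h | h
    · have := (hSF k h).1
      have := mul_le_mul_of_nonneg_left hm hC.le
      linarith
    · exact Or.inl h
    · have := (hSL k h).1
      linarith
    · exact Or.inr h
  have hθle : ∀ k, θ * α k ≤ α k := fun k => by
    have := hpos k
    nlinarith
  have hev : ∀ ε : ℝ, 0 < ε → ∃ M, ∀ k, M ≤ k → α k < lam * ε := by
    intro ε hε
    obtain ⟨N, hN⟩ := hlarge ε hε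
    have hex : ∃ M, N ≤ M ∧ α M < ε := by
      by_contra! hcon
      have hun : ∀ k, N ≤ k → k ∈ UF ∨ k ∈ UL := fun k hk => hN k hk (hcon k hk)
      have hmono : ∀ k, N ≤ k → α (k + 1) ≤ α k := by
        intro k hk
        rcases hun k hk with h | h
        · exact (hUF k h).2.1.le
        · rw [(hUL k h).2]; exact hθle k
      have htwo : ∀ k, N ≤ k → α (k + 2) ≤ θ * α k := by
        intro k hk
        rcases hun k hk with h | h
        · obtain ⟨-, h2, h3⟩ := hUF k h
          have h4 : k + 1 ∈ UL := by
            rcases hun (k + 1) (by omega) with h5 | h5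
            · rcases h3 with h3 | h3
              · exact absurd h3 (Set.disjoint_left.1 hd4 h5)
              · exact h3
            · exact h5
          have := (hUL _ h4).2
          rw [h2] at this
          exact this.le
        · have := hmono (k + 1) (by omega)
          rw [(hUL k h).2] at this
          exact this
      have hgeo : ∀ j : ℕ, α (N + 2 * j) ≤ θ ^ j * α N := by
        intro j
        induction j with
        | zero => simp
        | succ j ih =>
          have h1 := htwo (N + 2 * j) (by omega)
          have h2 := mul_le_mul_of_nonneg_left ih hθ0.le
          calc α (N + 2 * (j + 1)) = α (N + 2 * j + 2) := by congr 1
            _ ≤ θ * (θ ^ j * α N) := h1.trans h2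
            _ = θ ^ (j + 1) * α N := by ring
      have ht : Tendsto (fun j : ℕ => θ ^ j * α N) atTop (𝓝 0) := by
        simpa using (tendsto_pow_atTop_nhds_zero_of_lt_one hθ0.le hθ1).mul_const (α N)
      obtain ⟨j, hj⟩ := (ht.eventually (gt_mem_nhds hε)).exists
      have := hcon (N + 2 * j) (by omega)
      have := hgeo j
      linarith
    obtain ⟨M, hNM, hM⟩ := hex
    have hεl : ε ≤ lam * ε := by nlinarith
    refine ⟨M, fun k hk => ?_⟩
    induction k, hk using Nat.le_induction with
    | base => linarith
    | succ k hk ih =>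
      rcases lt_or_ge (α k) ε with h | h
      · have h1 : lam * α k < lam * ε := mul_lt_mul_of_pos_left h hlam0
        rcases hcase k with h' | h' | h' | h'
        · rw [(hSF k h').2]; exact ih
        · rw [(hUF k h').2.1]; exact ih
        · rw [(hSL k h').2]; exact h1
        · rw [(hUL k h').2]; exact (hθle k).trans_lt ih
      · rcases hN k (by omega) h with h' | h'
        · rw [(hUF k h').2.1]; exact ih
        · rw [(hUL k h').2]; exact (hθle k).trans_lt ih
  have hα : Tendsto α atTop (𝓝 0) := by
    rw [Metric.tendsto_atTop]
    intro ε hε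
    obtain ⟨M, hM⟩ := hev (ε / lam) (by positivity)
    refine ⟨M, fun k hk => ?_⟩
    have := hM k hk
    rw [mul_div_cancel₀ _ hlam0.ne'] at this
    rw [Real.dist_eq, sub_zero, abs_of_pos (hpos k)]
    exact this
  have hinf : UL.Infinite := by
    intro hfin
    obtain ⟨B, hB⟩ := hfin.bddAbove
    have hge : ∀ k, B + 1 ≤ k → α (B + 1) ≤ α k := by
      intro k hk
      induction k, hk using Nat.le_induction with
      | base => exact le_rfl
      | succ k hk ih =>
        rcases hcase k with h | h | h | h
        · rw [(hSF k h).2]; exact ih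
        · rw [(hUF k h).2.1]; exact ih
        · rw [(hSL k h).2]
          have := hpos k
          nlinarith
        · have := hB h
          omega
    have := ge_of_tendsto hα (eventually_atTop.2 ⟨B + 1, hge⟩)
    have := hpos (B + 1)
    linarith
  refine ⟨hα, hinf, ?_⟩
  have hφm : StrictMono (Nat.nth (· ∈ UL)) := Nat.nth_strictMono hinf
  obtain ⟨xs, -, ψ, hψ, hx⟩ := tendsto_subseq_of_bounded hbdd
    (x := fun j => x (Nat.nth (· ∈ UL) j)) (fun j => Set.mem_range_self _)
  have hg : StrictMono (fun j => Nat.nth (· ∈ UL) (ψ j)) := hφm.comp hψ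
  refine ⟨xs, Set.range (fun j => Nat.nth (· ∈ UL) (ψ j)), ?_, ?_, ?_, hα.mono_left inf_le_left⟩
  · rintro _ ⟨j, rfl⟩
    exact Nat.nth_mem_of_infinite hinf _
  · exact Set.infinite_range_of_injective hg.injective
  · intro s hs
    obtain ⟨J, hJ⟩ := eventually_atTop.1 (hx.eventually hs)
    rw [mem_map, mem_inf_principal]
    filter_upwards [eventually_ge_atTop (Nat.nth (· ∈ UL) (ψ J))]
    rintro _ hk ⟨j, rfl⟩
    exact hJ j (hg.le_iff_le.1 hk)
end

section
/- (Proposition 3.5, finite termination of the criticality step.) Let f : ℝⁿ → ℝ be differentiable with gradient ∇f Lipschitz continuous with constant L > 0, and let x ∈ ℝⁿ satisfy ∇f(x) ≠ 0. Let u_g' > 0, β > 0, ω ∈ (0,1), and let G_0 > 0 be given (the norm of the initial finite-difference gradient approximation). For each j ≥ 1 set h_j = ω^j u_g' β G_0 and let g_j = ∇_{h_j} f(x) be the forward finite-difference gradient of f at x with parameter h_j. Then there exists j ≥ 1 such that h_j ≤ u_g' β ‖g_j‖. -/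
/-- The forward finite-difference gradient of `f` at `x` with parameter `h`:
its `i`-th component is `(f(x + h eᵢ) − f(x)) / h`. -/
noncomputable def fdGrad {n : ℕ} (f : EuclideanSpace ℝ (Fin n) → ℝ)
    (x : EuclideanSpace ℝ (Fin n)) (h : ℝ) : EuclideanSpace ℝ (Fin n) :=
  (EuclideanSpace.equiv (Fin n) ℝ).symm
    (fun i => (f (x + h • EuclideanSpace.single i (1 : ℝ)) - f x) / h)

/-- **Proposition 3.5.** Finite termination of the criticality
step: if `∇f(x) ≠ 0`, then for `h_j = ωʲ u_g' β G₀` there is some `j ≥ 1` with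
`h_j ≤ u_g' β ‖∇_{h_j} f(x)‖`. -/
theorem criticality_step_terminates {n : ℕ}
    (f : EuclideanSpace ℝ (Fin n) → ℝ) (L : ℝ) (hL : 0 < L)
    (hdiff : Differentiable ℝ f)
    (hlip : ∀ y z : EuclideanSpace ℝ (Fin n),
      ‖gradient f y - gradient f z‖ ≤ L * ‖y - z‖)
    (x : EuclideanSpace ℝ (Fin n)) (hgrad : gradient f x ≠ 0)
    (ug' β ω G₀ : ℝ) (hug' : 0 < ug') (hβ : 0 < β)
    (hω0 : 0 < ω) (hω1 : ω < 1) (hG₀ : 0 < G₀) :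
    ∃ j : ℕ, 1 ≤ j ∧
      ω ^ j * ug' * β * G₀ ≤
        ug' * β * ‖fdGrad f x (ω ^ j * ug' * β * G₀)‖ := by
  have hlim : Filter.Tendsto (fun j : ℕ => ω ^ j * ug' * β * G₀) Filter.atTop (nhds 0) := by
    have h := tendsto_pow_atTop_nhds_zero_of_lt_one hω0.le hω1
    simpa using ((h.mul_const ug').mul_const β).mul_const G₀
  have hlim' : Filter.Tendsto (fun j : ℕ => ω ^ j * ug' * β * G₀) Filter.atTop
      (nhdsWithin 0 {0}ᶜ) := by
    refine tendsto_nhdsWithin_iff.2 ⟨hlim, Filter.Eventually.of_forall fun j => ?_⟩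
    have : 0 < ω ^ j * ug' * β * G₀ := by positivity
    exact this.ne'
  have hfd : Filter.Tendsto (fdGrad f x) (nhdsWithin 0 {0}ᶜ) (nhds (gradient f x)) := by
    have key : Filter.Tendsto
        (fun h : ℝ => fun i : Fin n =>
          (f (x + h • EuclideanSpace.single i (1 : ℝ)) - f x) / h)
        (nhdsWithin 0 {0}ᶜ) (nhds (EuclideanSpace.equiv (Fin n) ℝ (gradient f x))) := by
      refine tendsto_pi_nhds.2 fun i => ?_
      have h1 := ((hdiff x).hasGradientAt.hasFDerivAt.hasLineDerivAt
        (EuclideanSpace.single i (1 : ℝ))).tendsto_slope_zero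
      have h2 : (InnerProductSpace.toDual ℝ (EuclideanSpace ℝ (Fin n)) (gradient f x))
          (EuclideanSpace.single i (1 : ℝ)) = EuclideanSpace.equiv (Fin n) ℝ (gradient f x) i := by
        rw [InnerProductSpace.toDual_apply_apply, EuclideanSpace.inner_single_right]
        simp
      rw [h2] at h1
      refine h1.congr fun t => ?_
      simp [div_eq_inv_mul]
    have h3 := ((EuclideanSpace.equiv (Fin n) ℝ).symm.continuous.tendsto _).comp key
    rw [ContinuousLinearEquiv.symm_apply_apply] at h3
    exact h3
  have hR := (hfd.comp hlim').norm.const_mul (ug' * β)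
  have hpos : 0 < ug' * β * ‖gradient f x‖ := by
    have := norm_pos_iff.2 hgrad
    positivity
  obtain ⟨j, hj, hj1⟩ := ((hlim.eventually_lt hR hpos).and
    (Filter.eventually_ge_atTop 1)).exists
  exact ⟨j, hj1, hj.le⟩
end
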